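/- Let G ≠ P_n be a simple connected graph on n vertices. Then ξ^ac(G) > ξ^ac(P_n). -/

import Mathlib

open Finset SimpleGraph

/-- Degree of a vertex `u`: the number of neighbors of `u`. -/
noncomputable def deg {V : Type*} [Fintype V] (G : SimpleGraph V) (u : V) : ℕ :=
  {v | G.Adj u v}.ncard

/-- `M(u)`: the product of degrees of all neighbors of `u`. -/
noncomputable def Mprod {V : Type*} [Fintype V] (G : SimpleGraph V) (u : V) : ℕ :=
  ∏ᶠ v ∈ {v | G.Adj u v}, deg G v

/-- Eccentricity of a vertex `u`: the maximum distance from `u` to any vertex. -/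
noncomputable def ecc {V : Type*} [Fintype V] (G : SimpleGraph V) (u : V) : ℕ :=
  Finset.univ.sup fun v => G.dist u v

/-- Diameter of a graph: the maximum distance between two vertices. -/
noncomputable def gdiam {V : Type*} [Fintype V] (G : SimpleGraph V) : ℕ :=
  Finset.univ.sup fun u => ecc G u

/-- The augmented eccentric connectivity index `ξ^{ac}(G) = ∑_u M(u)/ε(u)`. -/
noncomputable def xiAC {V : Type*} [Fintype V] (G : SimpleGraph V) : ℝ :=
  ∑ u : V, (Mprod G u : ℝ) / (ecc G u : ℝ)

section Distances

variable {V : Type*} {G : SimpleGraph V}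

lemma dist_iso {W : Type*} {H : SimpleGraph W} (e : H ≃g G) (u v : W) : G.dist (e u) (e v) = H.dist u v := by
  simp only [dist_eq_sInf]
  congr 1
  ext k
  constructor
  · rintro ⟨p, rfl⟩
    exact ⟨(p.map e.symm.toHom).copy (e.symm_apply_apply u) (e.symm_apply_apply v), by simp⟩
  · rintro ⟨p, rfl⟩
    exact ⟨p.map e.toHom, by simp⟩

lemma exists_adj_dist_eq_add_one (hG : G.Connected) {u v : V} (huv : u ≠ v) :
    ∃ y, G.Adj u y ∧ G.dist u v = G.dist y v + 1 := by
  obtain ⟨p, hp⟩ := hG.exists_walk_length_eq_dist u v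
  cases p with
  | nil => exact absurd rfl huv
  | @cons _ y _ h p =>
    refine ⟨y, h, ?_⟩
    have h1 := dist_le p
    have h2 := hG.dist_triangle (u := u) (v := y) (w := v)
    rw [dist_eq_one_iff_adj.2 h] at h2
    rw [Walk.length_cons] at hp
    omega

/-- If the only neighbor of `w` is `x`, distances from `w` factor through `x`. -/
lemma dist_eq_add_one_of_leaf (hG : G.Connected) {w x : V} (hw : ∀ y, G.Adj w y → y = x)
    {v : V} (hv : v ≠ w) : G.dist w v = G.dist x v + 1 := by
  obtain ⟨y, hy, h⟩ := exists_adj_dist_eq_add_one hG hv.symm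
  rwa [hw y hy] at h

lemma exists_dist_eq_of_le (hG : G.Connected) (a : V) {b : V} {k : ℕ} (hk : k ≤ G.dist a b) :
    ∃ v, G.dist a v = k := by
  induction hk using Nat.decreasingInduction with
  | self => exact ⟨b, rfl⟩
  | of_succ k _ ih =>
    obtain ⟨v, hv⟩ := ih
    have hne : v ≠ a := by
      rintro rfl
      simp at hv
    obtain ⟨y, -, h⟩ := exists_adj_dist_eq_add_one hG hne
    refine ⟨y, ?_⟩
    rw [dist_comm, h, dist_comm] at hv
    omega

lemma walk_retract {W : Type*} {H : SimpleGraph W} (r : V → W)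
    (hr : ∀ x y, G.Adj x y → r x = r y ∨ H.Adj (r x) (r y)) {u v : V} (p : G.Walk u v) :
    ∃ q : H.Walk (r u) (r v), q.length ≤ p.length := by
  induction p with
  | nil => exact ⟨.nil, le_rfl⟩
  | @cons a b c h p ih =>
    obtain ⟨q, hq⟩ := ih
    rcases hr a b h with hab | hab
    · exact ⟨q.copy hab.symm rfl, by simp; omega⟩
    · exact ⟨.cons hab q, by simpa using hq⟩

lemma leaf_retract {w x : V} (hwx : G.Adj w x) (hw : ∀ y, G.Adj w y → y = x) :
    ∃ r : V → ({w}ᶜ : Set V), (∀ v : ({w}ᶜ : Set V), r v = v) ∧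
      ∀ a b, G.Adj a b → r a = r b ∨ (G.induce ({w}ᶜ : Set V)).Adj (r a) (r b) := by
  classical
  refine ⟨fun v => if h : v = w then ⟨x, hwx.ne'⟩ else ⟨v, h⟩, ?_, ?_⟩
  · rintro ⟨v, hv⟩
    exact dif_neg hv
  · intro a b hab
    by_cases ha : a = w <;> by_cases hb : b = w
    · exact absurd (ha.trans hb.symm) hab.ne
    · subst ha
      left
      simp [hw b hab, hwx.ne']
    · subst hb
      left
      simp [hw a hab.symm, hwx.ne']
    · right
      simpa [ha, hb] using hab

lemma connected_induce_leaf (hG : G.Connected) {w x : V} (hwx : G.Adj w x)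
    (hw : ∀ y, G.Adj w y → y = x) : (G.induce ({w}ᶜ : Set V)).Connected := by
  obtain ⟨r, hr, hadj⟩ := leaf_retract hwx hw
  have : Nonempty ({w}ᶜ : Set V) := ⟨⟨x, hwx.ne'⟩⟩
  refine ⟨fun u v => ?_⟩
  obtain ⟨p⟩ := hG u v
  obtain ⟨q, -⟩ := walk_retract r hadj p
  rw [hr, hr] at q
  exact ⟨q⟩

lemma dist_induce_leaf (hG : G.Connected) {w x : V} (hwx : G.Adj w x)
    (hw : ∀ y, G.Adj w y → y = x) (u v : ({w}ᶜ : Set V)) :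
    (G.induce ({w}ᶜ : Set V)).dist u v = G.dist u v := by
  obtain ⟨r, hr, hadj⟩ := leaf_retract hwx hw
  apply le_antisymm
  · obtain ⟨p, hp⟩ := hG.exists_walk_length_eq_dist (u : V) v
    obtain ⟨q, hq⟩ := walk_retract r hadj p
    rw [← hp]
    have := (dist_le q).trans hq
    rwa [hr, hr] at this
  · obtain ⟨p, hp⟩ := (connected_induce_leaf hG hwx hw).exists_walk_length_eq_dist u v
    rw [← hp, ← Walk.length_map (Embedding.induce ({w}ᶜ : Set V)).toHom p]
    exact dist_le _

lemma isTree_induce_leaf (hG : G.IsTree) {w x : V} (hwx : G.Adj w x)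
    (hw : ∀ y, G.Adj w y → y = x) : (G.induce ({w}ᶜ : Set V)).IsTree :=
  ⟨connected_induce_leaf hG.1 hwx hw, hG.2.induce _⟩

end Distances

section Degrees

variable {V W : Type*} [Fintype V] [Fintype W] {G : SimpleGraph V} {H : SimpleGraph W}

open Classical in
lemma deg_eq_degree (G : SimpleGraph V) (u : V) : deg G u = G.degree u := by
  rw [deg, ← card_neighborFinset_eq_degree, ← Set.ncard_coe_finset, coe_neighborFinset]
  rfl

open Classical in
lemma Mprod_eq_prod (G : SimpleGraph V) (u : V) :
    Mprod G u = ∏ v ∈ G.neighborFinset u, deg G v := by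
  rw [Mprod, ← finprod_mem_coe_finset, coe_neighborFinset]
  rfl

lemma deg_pos_of_adj {u v : V} (h : G.Adj u v) : 0 < deg G v := by
  classical
  rw [deg_eq_degree, degree_pos_iff_exists_adj]
  exact ⟨u, h.symm⟩

lemma deg_le_of_hom (f : H →g G) (hf : Function.Injective f) (u : W) :
    deg H u ≤ deg G (f u) := by
  rw [deg, deg, ← Set.ncard_image_of_injective _ hf]
  refine Set.ncard_le_ncard ?_ (Set.toFinite _)
  rintro _ ⟨v, hv, rfl⟩
  exact f.map_adj hv

open Classical in
lemma prod_deg_le_Mprod (f : H →g G) (hf : Function.Injective f) (u : W) :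
    ∏ v ∈ H.neighborFinset u, deg G (f v) ≤ Mprod G (f u) := by
  rw [Mprod_eq_prod, ← Finset.prod_image (s := H.neighborFinset u) (g := f) (f := deg G)
    fun _ _ _ _ h => hf h]
  refine Finset.prod_le_prod_of_subset_of_one_le' ?_ ?_
  · intro v hv
    obtain ⟨z, hz, rfl⟩ := Finset.mem_image.1 hv
    exact (mem_neighborFinset _ _ _).2 (f.map_adj ((mem_neighborFinset _ _ _).1 hz))
  · exact fun v hv _ => deg_pos_of_adj ((mem_neighborFinset _ _ _).1 hv)

lemma Mprod_le_of_hom (f : H →g G) (hf : Function.Injective f) (u : W) :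
    Mprod H u ≤ Mprod G (f u) := by
  classical
  refine le_trans ?_ (prod_deg_le_Mprod f hf u)
  rw [Mprod_eq_prod]
  exact Finset.prod_le_prod' fun v _ => deg_le_of_hom f hf v

lemma Mprod_lt_of_hom (f : H →g G) (hf : Function.Injective f) {z x : W} (hzx : H.Adj z x)
    (hx : deg H x < deg G (f x)) : Mprod H z < Mprod G (f z) := by
  classical
  refine lt_of_lt_of_le ?_ (prod_deg_le_Mprod f hf z)
  rw [Mprod_eq_prod]
  exact Finset.prod_lt_prod (fun v hv => deg_pos_of_adj ((mem_neighborFinset _ _ _).1 hv))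
    (fun v _ => deg_le_of_hom f hf v) ⟨x, (mem_neighborFinset _ _ _).2 hzx, hx⟩

lemma dist_le_ecc (G : SimpleGraph V) (u v : V) : G.dist u v ≤ ecc G u :=
  Finset.le_sup (f := fun v => G.dist u v) (Finset.mem_univ v)

lemma ecc_le_iff {u : V} {k : ℕ} : ecc G u ≤ k ↔ ∀ v, G.dist u v ≤ k := by
  simp [ecc, Finset.sup_le_iff]

lemma ecc_pos [Nontrivial V] (hG : G.Connected) (u : V) : 0 < ecc G u := by
  obtain ⟨v, hv⟩ := exists_ne u
  exact (hG.pos_dist_of_ne hv.symm).trans_le (dist_le_ecc G u v)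

lemma xiAC_le_sum_of_hom (f : H →g G) (hf : Function.Injective f)
    (hpos : ∀ u, 0 < ecc G (f u)) (hecc : ∀ u, ecc G (f u) ≤ ecc H u) :
    xiAC H ≤ ∑ u, (Mprod G (f u) : ℝ) / (ecc G (f u) : ℝ) := by
  refine Finset.sum_le_sum fun u _ => ?_
  have h0 : (0 : ℝ) < ecc G (f u) := by exact_mod_cast hpos u
  have h1 : (ecc G (f u) : ℝ) ≤ ecc H u := by exact_mod_cast hecc u
  have h2 : (Mprod H u : ℝ) ≤ Mprod G (f u) := by exact_mod_cast Mprod_le_of_hom f hf u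
  gcongr

lemma xiAC_add_le_sum_of_hom (f : H →g G) (hf : Function.Injective f)
    (hpos : ∀ u, 0 < ecc G (f u)) (hecc : ∀ u, ecc G (f u) ≤ ecc H u) {z x : W}
    (hzx : H.Adj z x) (hx : deg H x < deg G (f x)) :
    xiAC H + 1 / (ecc G (f z) : ℝ) ≤ ∑ u, (Mprod G (f u) : ℝ) / (ecc G (f u) : ℝ) := by
  classical
  have key : xiAC H + ∑ u, (if u = z then 1 / (ecc G (f z) : ℝ) else 0) ≤
      ∑ u, (Mprod G (f u) : ℝ) / (ecc G (f u) : ℝ) := by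
    rw [xiAC, ← Finset.sum_add_distrib]
    refine Finset.sum_le_sum fun u _ => ?_
    have h0 : (0 : ℝ) < ecc G (f u) := by exact_mod_cast hpos u
    have h1 : (ecc G (f u) : ℝ) ≤ ecc H u := by exact_mod_cast hecc u
    have h2 : (Mprod H u : ℝ) ≤ Mprod G (f u) := by exact_mod_cast Mprod_le_of_hom f hf u
    have h3 : (Mprod H u : ℝ) / ecc H u ≤ Mprod H u / ecc G (f u) := by gcongr
    split_ifs with h
    · subst h
      have h4 : (Mprod H u : ℝ) + 1 ≤ Mprod G (f u) := by
        exact_mod_cast Mprod_lt_of_hom f hf hzx hx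
      calc _ ≤ (Mprod H u : ℝ) / ecc G (f u) + 1 / ecc G (f u) := by gcongr
        _ = (Mprod H u + 1) / ecc G (f u) := by ring
        _ ≤ _ := by gcongr
    · rw [add_zero]
      exact h3.trans (by gcongr)
  simpa using key

lemma xiAC_le_of_iso [Nontrivial V] (hG : G.Connected) (e : H ≃g G) : xiAC H ≤ xiAC G := by
  refine (xiAC_le_sum_of_hom e.toHom e.injective (fun u => ecc_pos hG _) fun u => ?_).trans_eq
    (Equiv.sum_comp e.toEquiv fun u => (Mprod G u : ℝ) / (ecc G u : ℝ))
  refine ecc_le_iff.2 fun v => ?_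
  have := dist_iso e u (e.symm v)
  rw [e.apply_symm_apply] at this
  exact this.trans_le (dist_le_ecc H u _)

end Degrees

lemma exists_of_deg_eq_one {V : Type*} [Fintype V] {G : SimpleGraph V} {w : V}
    (h : deg G w = 1) : ∃ x, G.Adj w x ∧ ∀ y, G.Adj w y → y = x := by
  obtain ⟨x, hx⟩ := Set.ncard_eq_one.1 h
  have hiff : ∀ y, G.Adj w y ↔ y = x := fun y => Set.ext_iff.1 hx y
  exact ⟨x, (hiff x).2 rfl, fun y => (hiff y).1⟩

lemma card_compl_singleton {V : Type*} [Fintype V] (w : V) [Fintype ({w}ᶜ : Set V)] :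
    Fintype.card ({w}ᶜ : Set V) = Fintype.card V - 1 := by
  classical
  rw [Fintype.card_compl_set]
  simp

/-- The four-point condition for the metric of a finite tree. -/
lemma four_point {V : Type*} [Fintype V] {G : SimpleGraph V} (hG : G.IsTree) (u v a b : V) :
    G.dist u v + G.dist a b ≤
      max (G.dist u a + G.dist v b) (G.dist u b + G.dist v a) := by
  classical
  induction hn : Fintype.card V using Nat.strong_induction_on generalizing V with
  | _ n ih =>
  rcases subsingleton_or_nontrivial V with hV | hV
  · simp [Subsingleton.elim v u, Subsingleton.elim a u, Subsingleton.elim b u]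
  obtain ⟨w, hw1⟩ := hG.exists_vert_degree_one_of_nontrivial
  rw [← deg_eq_degree] at hw1
  obtain ⟨x, hwx, hw⟩ := exists_of_deg_eq_one hw1
  have hpos := Fintype.card_pos (α := V)
  have IH : ∀ u v a b : V, u ≠ w → v ≠ w → a ≠ w → b ≠ w → G.dist u v + G.dist a b ≤
      max (G.dist u a + G.dist v b) (G.dist u b + G.dist v a) := by
    intro u v a b hu hv ha hb
    have := ih (Fintype.card ({w}ᶜ : Set V)) (by rw [card_compl_singleton]; omega)
      (isTree_induce_leaf hG hwx hw) ⟨u, hu⟩ ⟨v, hv⟩ ⟨a, ha⟩ ⟨b, hb⟩ rfl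
    simpa only [dist_induce_leaf hG.1 hwx hw] using this
  have hd : ∀ v, v ≠ w → G.dist w v = G.dist x v + 1 :=
    fun v hv => dist_eq_add_one_of_leaf hG.1 hw hv
  have hd' : ∀ v, v ≠ w → G.dist v w = G.dist v x + 1 := fun v hv => by
    rw [dist_comm, hd v hv, dist_comm]
  have hx := hwx.ne'
  have tri := fun a b c => hG.1.dist_triangle (u := a) (v := b) (w := c)
  have hs := fun a b => G.dist_comm (u := a) (v := b)
  have h0 : ∀ a, G.dist a a = 0 := fun a => dist_self
  by_cases hu : u = w
  · by_cases hv : v = w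
    · rw [hu, hv, h0]
      have := tri a w b; have := hs a w; omega
    by_cases ha : a = w
    · rw [hu, ha, h0]
      have := tri v w b; have := hs v w; omega
    by_cases hb : b = w
    · rw [hu, hb, h0]
      have := tri v w a; have := hs v w; have := hs a w; omega
    · have := IH x v a b hx hv ha hb
      rw [hu, hd v hv, hd a ha, hd b hb]; omega
  by_cases hv : v = w
  · by_cases ha : a = w
    · rw [hv, ha, h0]
      have := tri u w b; omega
    by_cases hb : b = w
    · rw [hv, hb, h0]
      have := tri u w a; have := hs a w; omega
    · have := IH u x a b hu hx ha hb
      rw [hv, hd' u hu, hd a ha, hd b hb]; omega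
  by_cases ha : a = w
  · by_cases hb : b = w
    · rw [ha, hb, h0]
      have := tri u w v; have := hs w v; omega
    · have := IH u v x b hu hv hx hb
      rw [ha, hd' u hu, hd' v hv, hd b hb]; omega
  by_cases hb : b = w
  · have := IH u v a x hu hv ha hx
    rw [hb, hd' u hu, hd' v hv, hd' a ha]; omega
  · exact IH u v a b hu hv ha hb

section PathRecognition

variable {V : Type*} [Fintype V] {G : SimpleGraph V}

lemma range_subset_image_dist [DecidableEq V] (hG : G.Connected) (a b : V) :
    Finset.range (G.dist a b + 1) ⊆ Finset.univ.image (G.dist a) := by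
  intro k hk
  obtain ⟨v, hv⟩ := exists_dist_eq_of_le hG a (b := b) (k := k)
    (by have := Finset.mem_range.1 hk; omega)
  exact Finset.mem_image.2 ⟨v, Finset.mem_univ v, hv⟩

lemma dist_lt_card (hG : G.Connected) (a b : V) : G.dist a b < Fintype.card V := by
  classical
  have h := (Finset.card_le_card (range_subset_image_dist hG a b)).trans Finset.card_image_le
  rwa [Finset.card_range, Finset.card_univ] at h

lemma dist_injective_of_card_le (hG : G.Connected) {a b : V}
    (h : Fintype.card V ≤ G.dist a b + 1) : Function.Injective (G.dist a) := by
  classical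
  have h1 := Finset.card_le_card (range_subset_image_dist hG a b)
  rw [Finset.card_range] at h1
  have h2 : (Finset.univ.image (G.dist a)).card = (Finset.univ : Finset V).card :=
    le_antisymm Finset.card_image_le (h.trans h1)
  intro u v huv
  exact Finset.card_image_iff.1 h2 (Finset.mem_coe.2 (Finset.mem_univ u))
    (Finset.mem_coe.2 (Finset.mem_univ v)) huv

lemma iso_pathGraph_of_dist_injective (hG : G.Connected) {a : V}
    (ha : Function.Injective (G.dist a)) : Nonempty (G ≃g pathGraph (Fintype.card V)) := by
  have hbij : Function.Bijective
      (fun v => (⟨G.dist a v, dist_lt_card hG a v⟩ : Fin (Fintype.card V))) :=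
    (Fintype.bijective_iff_injective_and_card _).2
      ⟨fun u v h => ha (Fin.mk.inj_iff.1 h), by simp⟩
  have step : ∀ u v, G.dist a u + 1 = G.dist a v → G.Adj u v := by
    intro u v h
    have hne : v ≠ a := by
      rintro rfl
      simp at h
    obtain ⟨y, hy, hd⟩ := exists_adj_dist_eq_add_one hG hne
    rw [dist_comm, dist_comm (u := y)] at hd
    have : y = u := ha (by omega)
    exact this ▸ hy.symm
  refine ⟨⟨Equiv.ofBijective _ hbij, ?_⟩⟩
  intro u v
  rw [pathGraph_adj]
  simp only [Equiv.ofBijective_apply]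
  constructor
  · rintro (h | h)
    · exact step u v h
    · exact (step v u h).symm
  · intro h
    have h1 := hG.dist_triangle (u := a) (v := u) (w := v)
    have h2 := hG.dist_triangle (u := a) (v := v) (w := u)
    rw [dist_eq_one_iff_adj.2 h] at h1
    rw [dist_eq_one_iff_adj.2 h.symm] at h2
    have h3 : G.dist a u ≠ G.dist a v := fun h' => h.ne (ha h')
    omega

lemma dist_add_two_le_card (hG : G.Connected)
    (hP : ¬ Nonempty (G ≃g pathGraph (Fintype.card V))) (a b : V) :
    G.dist a b + 2 ≤ Fintype.card V := by
  by_contra h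
  exact hP (iso_pathGraph_of_dist_injective hG (dist_injective_of_card_le hG (a := a) (b := b)
    (by omega)))

lemma dist_injective_of_deg_le (hG : G.Connected) {a : V} (ha : deg G a ≤ 1)
    (h2 : ∀ v, deg G v ≤ 2) : Function.Injective (G.dist a) := by
  suffices H : ∀ k u v, G.dist a u = k → G.dist a v = k → u = v from
    fun u v h => H _ u v h rfl
  intro k
  induction k with
  | zero =>
    intro u v hu hv
    rw [hG.dist_eq_zero_iff] at hu hv
    exact hu.symm.trans hv
  | succ k ih =>
    intro u v hu hv
    have parent : ∀ z j, G.dist a z = j + 1 → ∃ p, G.Adj p z ∧ G.dist a p = j := by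
      intro z j hz
      have hne : z ≠ a := by
        rintro rfl
        simp at hz
      obtain ⟨y, hy, hd⟩ := exists_adj_dist_eq_add_one hG hne
      rw [dist_comm, dist_comm (u := y)] at hd
      exact ⟨y, hy.symm, by omega⟩
    obtain ⟨p, hpu, hp⟩ := parent u k hu
    obtain ⟨q, hqv, hq⟩ := parent v k hv
    obtain rfl := ih p q hp hq
    by_contra huv
    rcases k with _ | k
    · rw [hG.dist_eq_zero_iff] at hp
      subst hp
      have : 1 < deg G a := (Set.one_lt_ncard_iff (Set.toFinite _)).2 ⟨u, v, hpu, hqv, huv⟩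
      omega
    · obtain ⟨z, hzp, hz⟩ := parent p k hp
      have : 2 < deg G p := (Set.two_lt_ncard_iff (Set.toFinite _)).2
        ⟨u, v, z, hpu, hqv, hzp.symm, huv, by rintro rfl; omega, by rintro rfl; omega⟩
      have := h2 p
      omega

lemma exists_leaf_ne_ne [Nontrivial V] (hG : G.IsTree)
    (hP : ¬ Nonempty (G ≃g pathGraph (Fintype.card V))) (a b : V) :
    ∃ w, w ≠ a ∧ w ≠ b ∧ deg G w = 1 := by
  classical
  by_contra! hw
  have hdeg : ∀ v, 0 < deg G v := fun v => by
    obtain ⟨y, hy⟩ := exists_ne v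
    obtain ⟨z, hz, -⟩ := exists_adj_dist_eq_add_one hG.1 hy.symm
    exact deg_pos_of_adj hz.symm
  have hsum : ∑ v, (deg G v + ((if v = a then 1 else 0) + (if v = b then 1 else 0))) =
      ∑ _v : V, 2 := by
    have h1 := G.sum_degrees_eq_twice_card_edges
    have h2 := hG.card_edgeFinset
    simp only [Finset.sum_add_distrib, deg_eq_degree, h1]
    simp
    omega
  have hle : ∀ v ∈ (Finset.univ : Finset V),
      2 ≤ deg G v + ((if v = a then 1 else 0) + (if v = b then 1 else 0)) := by
    intro v _
    have h1 := hdeg v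
    have h2 := hw v
    split_ifs with ha hb hb <;> try omega
    have := h2 ha hb
    omega
  have heq := (Finset.sum_eq_sum_iff_of_le hle).1 hsum.symm
  refine hP (iso_pathGraph_of_dist_injective hG.1 (a := a) (dist_injective_of_deg_le hG.1 ?_ ?_))
  · have := heq a (Finset.mem_univ a)
    simp only [if_true] at this
    omega
  · intro v
    have := heq v (Finset.mem_univ v)
    omega

end PathRecognition

section PathValue

lemma dist_pathGraph_le {n : ℕ} (k : ℕ) (i j : Fin n) (h : (i : ℕ) + k = j) :
    (pathGraph n).dist i j ≤ k := by
  have hc : (pathGraph n).Connected := by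
    have : Nonempty (Fin n) := ⟨i⟩
    exact ⟨pathGraph_preconnected n⟩
  induction k generalizing j with
  | zero =>
    obtain rfl : i = j := Fin.ext (by omega)
    simp
  | succ k ih =>
    have hj := j.isLt
    have h1 := ih ⟨i + k, by omega⟩ rfl
    have h2 : (pathGraph n).dist ⟨i + k, by omega⟩ j = 1 :=
      dist_eq_one_iff_adj.2 (pathGraph_adj.2 (Or.inl (by simp; omega)))
    have h3 := hc.dist_triangle (u := i) (v := ⟨i + k, by omega⟩) (w := j)
    omega

lemma le_add_dist_pathGraph {n : ℕ} (i j : Fin n) :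
    (j : ℕ) ≤ i + (pathGraph n).dist i j ∧ (i : ℕ) ≤ j + (pathGraph n).dist i j := by
  have hw : ∀ i j : Fin n, ∀ p : (pathGraph n).Walk i j,
      (j : ℕ) ≤ i + p.length ∧ (i : ℕ) ≤ j + p.length := by
    intro i j p
    induction p with
    | nil => simp
    | cons h p ih =>
      rw [pathGraph_adj] at h
      rw [Walk.length_cons]
      omega
  obtain ⟨p, hp⟩ := ((pathGraph_preconnected n) i j).exists_walk_length_eq_dist
  rw [← hp]
  exact hw i j p

lemma ecc_pathGraph {n : ℕ} (i : Fin n) : ecc (pathGraph n) i = max (i : ℕ) (n - 1 - i) := by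
  have hi := i.isLt
  apply le_antisymm
  · refine ecc_le_iff.2 fun j => ?_
    have hj := j.isLt
    rcases le_total (i : ℕ) j with h | h
    · exact (dist_pathGraph_le (j - i) i j (by omega)).trans (by omega)
    · rw [dist_comm]
      exact (dist_pathGraph_le (i - j) j i (by omega)).trans (by omega)
  · have h1 := (le_add_dist_pathGraph i ⟨0, by omega⟩).2
    have h2 := (le_add_dist_pathGraph i ⟨n - 1, by omega⟩).1
    have h3 := dist_le_ecc (pathGraph n) i ⟨0, by omega⟩
    have h4 := dist_le_ecc (pathGraph n) i ⟨n - 1, by omega⟩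
    simp only at h1 h2
    omega

lemma neighbors_pathGraph_zero {n : ℕ} (hn : 2 ≤ n) (i : Fin n) (hi : (i : ℕ) = 0) :
    {v | (pathGraph n).Adj i v} = {⟨1, by omega⟩} := by
  ext v
  simp only [Set.mem_ofPred_eq, pathGraph_adj, Set.mem_singleton_iff, Fin.ext_iff]
  omega

lemma neighbors_pathGraph_last {n : ℕ} (hn : 2 ≤ n) (i : Fin n) (hi : (i : ℕ) = n - 1) :
    {v | (pathGraph n).Adj i v} = {⟨n - 2, by omega⟩} := by
  ext v
  simp only [Set.mem_ofPred_eq, pathGraph_adj, Set.mem_singleton_iff, Fin.ext_iff]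
  omega

lemma neighbors_pathGraph_interior {n : ℕ} (i : Fin n) (h0 : 0 < (i : ℕ))
    (h1 : (i : ℕ) + 1 < n) :
    {v | (pathGraph n).Adj i v} = {⟨i - 1, by omega⟩, ⟨i + 1, h1⟩} := by
  ext v
  simp only [Set.mem_ofPred_eq, pathGraph_adj, Set.mem_insert_iff, Set.mem_singleton_iff,
    Fin.ext_iff]
  omega

lemma deg_pathGraph {n : ℕ} (hn : 2 ≤ n) (i : Fin n) :
    deg (pathGraph n) i = if (i : ℕ) = 0 ∨ (i : ℕ) = n - 1 then 1 else 2 := by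
  have hi := i.isLt
  unfold deg
  split_ifs with h
  · rcases h with h | h
    · rw [neighbors_pathGraph_zero hn i h, Set.ncard_singleton]
    · rw [neighbors_pathGraph_last hn i h, Set.ncard_singleton]
  · rw [neighbors_pathGraph_interior i (by omega) (by omega), Set.ncard_pair]
    simp only [ne_eq, Fin.mk.injEq]
    omega

lemma Mprod_pathGraph {n : ℕ} (hn : 3 ≤ n) (i : Fin n) :
    Mprod (pathGraph n) i =
      if (i : ℕ) = 0 ∨ (i : ℕ) = n - 1 then 2 else
        (if (i : ℕ) = 1 then 1 else 2) * (if (i : ℕ) = n - 2 then 1 else 2) := by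
  have hi := i.isLt
  unfold Mprod
  split_ifs with h h1 h2 h2
  · rcases h with h | h
    · rw [neighbors_pathGraph_zero (by omega) i h, finprod_mem_singleton,
        deg_pathGraph (by omega), if_neg (by simp only; omega)]
    · rw [neighbors_pathGraph_last (by omega) i h, finprod_mem_singleton,
        deg_pathGraph (by omega), if_neg (by simp only; omega)]
  all_goals
    rw [neighbors_pathGraph_interior i (by omega) (by omega),
      finprod_mem_pair (by simp only [ne_eq, Fin.mk.injEq]; omega),
      deg_pathGraph (by omega), deg_pathGraph (by omega)]
    simp only [Nat.add_eq_zero_iff, one_ne_zero, and_false, false_or]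
    split_ifs <;> omega

lemma xiAC_pathGraph_three : xiAC (pathGraph 3) = 3 := by
  simp only [xiAC, Mprod_pathGraph le_rfl, ecc_pathGraph, Fin.sum_univ_three]
  norm_num

/-- The sum that `xiAC (pathGraph n)` would be if every vertex `u` had `M(u) = 4`. -/
noncomputable def pathSum (n : ℕ) : ℝ :=
  ∑ i ∈ Finset.range n, 4 / ((max i (n - 1 - i) : ℕ) : ℝ)

lemma xiAC_pathGraph (n : ℕ) :
    xiAC (pathGraph (n + 4)) = pathSum (n + 4) - 4 / (n + 3) - 4 / (n + 2) := by
  have h : xiAC (pathGraph (n + 4)) = ∑ i ∈ Finset.range (n + 4),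
      (4 / ((max i (n + 4 - 1 - i) : ℕ) : ℝ) - ((if i = 0 then 2 / ((n : ℝ) + 3) else 0) +
        (if i = 1 then 2 / ((n : ℝ) + 2) else 0) + (if i = n + 2 then 2 / ((n : ℝ) + 2) else 0) +
        (if i = n + 3 then 2 / ((n : ℝ) + 3) else 0))) := by
    rw [← Fin.sum_univ_eq_sum_range (fun i => 4 / ((max i (n + 4 - 1 - i) : ℕ) : ℝ) -
      ((if i = 0 then 2 / ((n : ℝ) + 3) else 0) +
        (if i = 1 then 2 / ((n : ℝ) + 2) else 0) + (if i = n + 2 then 2 / ((n : ℝ) + 2) else 0) +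
        (if i = n + 3 then 2 / ((n : ℝ) + 3) else 0))) (n + 4)]
    refine Finset.sum_congr rfl fun i _ => ?_
    rw [Mprod_pathGraph (by omega), ecc_pathGraph]
    obtain ⟨i, hi⟩ := i
    simp only
    rcases (by omega : i = 0 ∨ i = 1 ∨ i = n + 2 ∨ i = n + 3 ∨
      (i ≠ 0 ∧ i ≠ 1 ∧ i ≠ n + 2 ∧ i ≠ n + 3)) with h | h | h | h | ⟨h0, h1, h2, h3⟩
    · rw [show max i (n + 4 - 1 - i) = n + 3 by omega]
      simp [h]
      ring
    · rw [show max i (n + 4 - 1 - i) = n + 2 by omega]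
      simp [h]
      ring
    · rw [show max i (n + 4 - 1 - i) = n + 2 by omega]
      simp [h]
      ring
    · rw [show max i (n + 4 - 1 - i) = n + 3 by omega]
      simp [h]
      ring
    · rw [if_neg (by omega), if_neg h1, if_neg (by omega), if_neg h0, if_neg h1, if_neg h2,
        if_neg h3]
      norm_num
  rw [h, Finset.sum_sub_distrib]
  simp only [Finset.sum_add_distrib, Finset.sum_ite_eq', Finset.mem_range]
  rw [if_pos (by omega), if_pos (by omega), if_pos (by omega), if_pos (by omega), pathSum]
  ring

lemma pathSum_eq (n : ℕ) : pathSum n =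
    ∑ i ∈ Finset.Ico ((n + 1) / 2) n, (4 : ℝ) / (i : ℝ) +
      ∑ i ∈ Finset.Ico (n / 2) n, (4 : ℝ) / (i : ℝ) := by
  rcases Nat.eq_zero_or_pos n with rfl | hn
  · simp [pathSum]
  rw [pathSum, Finset.range_eq_Ico,
    ← Finset.sum_Ico_consecutive _ (Nat.zero_le (n / 2)) (Nat.div_le_self n 2)]
  congr 1
  · have := Finset.sum_Ico_reflect (fun i : ℕ => (4 : ℝ) / (i : ℝ)) 0
      (m := n / 2) (n := n - 1) (by omega)
    rw [show n - 1 + 1 - n / 2 = (n + 1) / 2 by omega, show n - 1 + 1 - 0 = n by omega] at this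
    rw [← this]
    refine Finset.sum_congr rfl fun i hi => ?_
    rw [Finset.mem_Ico] at hi
    rw [max_eq_right (by omega)]
  · refine Finset.sum_congr rfl fun i hi => ?_
    rw [Finset.mem_Ico] at hi
    rw [max_eq_left (by omega)]

lemma pathSum_succ {n : ℕ} (hn : 0 < n) :
    pathSum (n + 1) = pathSum n + 8 / n - 4 / ((n / 2 : ℕ) : ℝ) := by
  rw [pathSum_eq, pathSum_eq, Finset.sum_Ico_succ_top (by omega),
    Finset.sum_Ico_succ_top (by omega), show (n + 1 + 1) / 2 = n / 2 + 1 by omega,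
    Finset.sum_eq_sum_Ico_succ_bot (show n / 2 < n by omega)]
  ring

lemma xiAC_pathGraph_four : xiAC (pathGraph 4) = 10 / 3 := by
  have h := xiAC_pathGraph 0
  simp only [pathSum, Finset.sum_range_succ, Finset.sum_range_zero] at h
  norm_num at h
  linarith

lemma xiAC_pathGraph_succ_le (n : ℕ) :
    xiAC (pathGraph (n + 5)) ≤ xiAC (pathGraph (n + 4)) + (4 / (n + 2) - 4 / (n + 4)) := by
  have h1 := xiAC_pathGraph (n + 1)
  rw [show n + 1 + 4 = n + 4 + 1 by ring, pathSum_succ (by omega)] at h1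
  rw [show n + 5 = n + 4 + 1 by ring, h1, xiAC_pathGraph n]
  have hle : (((n + 4) / 2 : ℕ) : ℝ) ≤ ((n : ℝ) + 4) / 2 := by
    have := Nat.cast_div_le (α := ℝ) (m := n + 4) (n := 2)
    exact_mod_cast this
  have hpos : (0 : ℝ) < (((n + 4) / 2 : ℕ) : ℝ) := by
    exact_mod_cast (by omega : 0 < (n + 4) / 2)
  have : (8 : ℝ) / (n + 4) ≤ 4 / (((n + 4) / 2 : ℕ) : ℝ) := by
    rw [div_le_div_iff₀ (by positivity) hpos]
    linarith
  have e1 : ((n + 1 : ℕ) : ℝ) + 3 = n + 4 := by push_cast; ring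
  have e2 : ((n + 1 : ℕ) : ℝ) + 2 = n + 3 := by push_cast; ring
  have e3 : ((n + 4 : ℕ) : ℝ) = n + 4 := by push_cast; ring
  rw [e1, e2, e3]
  have e4 : (8 : ℝ) / (n + 4) = 2 * (4 / (n + 4)) := by ring
  linarith

end PathValue

section Trees

variable {V : Type*} [Fintype V] {G : SimpleGraph V}

lemma deg_lt_of_hom {W : Type*} [Fintype W] {H : SimpleGraph W} (f : H →g G)
    (hf : Function.Injective f) {u : W} {y : V} (hy : G.Adj (f u) y)
    (hny : ∀ v, H.Adj u v → f v ≠ y) : deg H u < deg G (f u) := by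
  rw [deg, deg, ← Set.ncard_image_of_injective _ hf]
  refine Set.ncard_lt_ncard ⟨?_, fun h => ?_⟩ (Set.toFinite _)
  · rintro _ ⟨v, hv, rfl⟩
    exact f.map_adj hv
  · obtain ⟨v, hv, rfl⟩ := h hy
    exact hny v hv rfl

lemma Mprod_leaf {w x : V} (hwx : G.Adj w x) (hw : ∀ y, G.Adj w y → y = x) :
    Mprod G w = deg G x := by
  have : {v | G.Adj w v} = {x} :=
    Set.ext fun v => ⟨hw v, by rintro rfl; exact hwx⟩
  rw [Mprod, this, finprod_mem_singleton]

/-- In a tree, the vertices farthest from `u` include an end of any longest path. -/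
lemma dist_le_max_of_diametral (hG : G.IsTree) {a b : V}
    (hab : ∀ u v, G.dist u v ≤ G.dist a b) (u w : V) :
    G.dist u w ≤ max (G.dist u a) (G.dist u b) := by
  have h := four_point hG u w a b
  have h1 := hab w a
  have h2 := hab w b
  omega

lemma xiAC_induce_leaf_add_le [Nontrivial V] (hG : G.IsTree) {a b w x y : V}
    [Fintype ({w}ᶜ : Set V)]
    (hab : ∀ u v, G.dist u v ≤ G.dist a b) (hwa : w ≠ a) (hwb : w ≠ b)
    (hwx : G.Adj w x) (hw : ∀ z, G.Adj w z → z = x) (hxy : G.Adj x y) (hyw : y ≠ w) :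
    xiAC (G.induce ({w}ᶜ : Set V)) + 1 / (ecc G y : ℝ) + (deg G x : ℝ) / (ecc G w : ℝ) ≤
      xiAC G := by
  classical
  have hecc : ∀ u : ({w}ᶜ : Set V), ecc G u ≤ ecc (G.induce ({w}ᶜ : Set V)) u := by
    intro u
    have hd : ∀ v, v ≠ w → G.dist u v ≤ ecc (G.induce ({w}ᶜ : Set V)) u := fun v hv => by
      rw [← dist_induce_leaf hG.1 hwx hw u ⟨v, hv⟩]
      exact dist_le_ecc _ _ _
    refine ecc_le_iff.2 fun v => ?_
    by_cases hv : v = w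
    · subst hv
      exact (dist_le_max_of_diametral hG hab u v).trans
        (max_le (hd a hwa.symm) (hd b hwb.symm))
    · exact hd v hv
  have h := xiAC_add_le_sum_of_hom (Embedding.induce ({w}ᶜ : Set V)).toHom
    Subtype.val_injective (fun u => ecc_pos hG.1 _) hecc
    (z := ⟨y, hyw⟩) (x := ⟨x, hwx.ne'⟩) hxy.symm
    (deg_lt_of_hom _ Subtype.val_injective (y := w) hwx.symm fun v _ => v.2)
  have hsum : xiAC G = (Mprod G w : ℝ) / ecc G w +
      ∑ u : ({w}ᶜ : Set V), (Mprod G u : ℝ) / (ecc G u : ℝ) := by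
    rw [xiAC, Fintype.sum_eq_add_sum_compl w]
    congr 1
    exact Finset.sum_subtype _ (fun u => by simp) _
  rw [hsum, Mprod_leaf hwx hw]
  have h' : xiAC (G.induce ({w}ᶜ : Set V)) + 1 / (ecc G y : ℝ) ≤
      ∑ u : ({w}ᶜ : Set V), (Mprod G u : ℝ) / (ecc G u : ℝ) := h
  linarith

lemma ecc_le_two_of_deg_eq_two (hG : G.Connected) {w x y : V} (hwx : G.Adj w x)
    (hw : ∀ z, G.Adj w z → z = x) (hxy : G.Adj x y) (hyw : y ≠ w) (hx : deg G x = 2)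
    (hdist : ∀ v, G.dist w v ≤ 3) : ecc G y ≤ 2 := by
  have hnbr : ∀ z, G.Adj x z → z = w ∨ z = y := by
    intro z hz
    by_contra! h
    have : 2 < deg G x := (Set.two_lt_ncard_iff (Set.toFinite _)).2
      ⟨z, w, y, hz, hwx.symm, hxy, h.1, h.2, hyw.symm⟩
    omega
  have hyx : G.dist y x = 1 := dist_eq_one_iff_adj.2 hxy.symm
  refine ecc_le_iff.2 fun v => ?_
  by_cases hvw : v = w
  · have := hG.dist_triangle (u := y) (v := x) (w := w)
    rw [hyx, dist_eq_one_iff_adj.2 hwx.symm] at this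
    rw [hvw]
    omega
  by_cases hvx : v = x
  · rw [hvx]
    omega
  have h1 := dist_eq_add_one_of_leaf hG hw hvw
  obtain ⟨z, hz, h2⟩ := exists_adj_dist_eq_add_one hG (Ne.symm hvx)
  have h3 := hdist v
  rcases hnbr z hz with rfl | rfl <;> omega

/-- The part of the index gained by a new leaf exceeds the gain from lengthening a path. -/
lemma xiAC_pathGraph_lt_add {n D p q : ℕ} (hp0 : 0 < p) (hq0 : 0 < q) (hp : p + 1 ≤ n + 3)
    (hq : q + 1 ≤ n + 3) (hD : 2 ≤ D) (h5 : n = 1 → D = 2 → p ≤ 2) :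
    xiAC (pathGraph (n + 4)) < xiAC (pathGraph (n + 3)) + 1 / (p : ℝ) + (D : ℝ) / (q : ℝ) := by
  have hp0' : (0 : ℝ) < p := by exact_mod_cast hp0
  have hq0' : (0 : ℝ) < q := by exact_mod_cast hq0
  have hp' : (p : ℝ) ≤ n + 2 := by exact_mod_cast (by omega : p ≤ n + 2)
  have hq' : (q : ℝ) ≤ n + 2 := by exact_mod_cast (by omega : q ≤ n + 2)
  have hD' : (2 : ℝ) ≤ D := by exact_mod_cast hD
  have h1 : 1 / ((n : ℝ) + 2) ≤ 1 / p := by gcongr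
  have h2 : (D : ℝ) / (n + 2) ≤ D / q := by gcongr
  have h3 : (2 : ℝ) / (n + 2) ≤ D / (n + 2) := by gcongr
  rcases n with _ | _ | n
  · rw [xiAC_pathGraph_four, xiAC_pathGraph_three]
    norm_num at h1 h2 h3 ⊢
    linarith
  · have h4 := xiAC_pathGraph_succ_le 0
    norm_num at h1 h2 h3 h4 ⊢
    rcases hD.eq_or_lt with hD2 | hD3
    · have hp2 : (p : ℝ) ≤ 2 := by exact_mod_cast h5 rfl hD2.symm
      have h6 : (2 : ℝ)⁻¹ ≤ (p : ℝ)⁻¹ := by gcongr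
      linarith
    · have hD3' : (3 : ℝ) ≤ D := by exact_mod_cast hD3
      linarith
  · have h4 := xiAC_pathGraph_succ_le (n + 1)
    rw [show n + 1 + 1 + 4 = n + 1 + 5 by ring, show n + 1 + 1 + 3 = n + 1 + 4 by ring]
    push_cast at h1 h2 h3 h4 ⊢
    have hn : (0 : ℝ) ≤ n := Nat.cast_nonneg n
    have h6 : (4 : ℝ) / (n + 1 + 2) - 4 / (n + 1 + 4) <
        1 / (n + 1 + 1 + 2) + 2 / (n + 1 + 1 + 2) := by
      rw [← add_div, div_sub_div _ _ (by positivity) (by positivity),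
        div_lt_div_iff₀ (by positivity) (by positivity)]
      nlinarith [mul_nonneg hn hn, mul_nonneg (mul_nonneg hn hn) hn]
    linarith

theorem xiAC_tree_gt_path (hG : G.IsTree)
    (hP : ¬ Nonempty (G ≃g pathGraph (Fintype.card V))) :
    xiAC (pathGraph (Fintype.card V)) < xiAC G := by
  classical
  induction hn : Fintype.card V using Nat.strong_induction_on generalizing V with
  | _ n ih =>
  have hne := hG.1.nonempty
  rcases subsingleton_or_nontrivial V with hV | hV
  · exact absurd (iso_pathGraph_of_dist_injective hG.1 (a := hne.some)
      fun u v _ => Subsingleton.elim u v) hP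
  obtain ⟨⟨a, b⟩, hab'⟩ := Finite.exists_max fun p : V × V => G.dist p.1 p.2
  have hab : ∀ u v, G.dist u v ≤ G.dist a b := fun u v => hab' (u, v)
  have hne_ab : a ≠ b := by
    rintro rfl
    obtain ⟨c, hc⟩ := exists_ne a
    have h1 := hG.1.pos_dist_of_ne hc
    have h2 := hab c a
    rw [dist_self] at h2
    omega
  obtain ⟨w, hwa, hwb, hw1⟩ := exists_leaf_ne_ne hG hP a b
  obtain ⟨x, hwx, hw⟩ := exists_of_deg_eq_one hw1
  obtain ⟨v, hvw, hvx⟩ : ∃ v, v ≠ w ∧ v ≠ x := by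
    by_cases hax : a = x
    · exact ⟨b, hwb.symm, fun h => hne_ab (hax.trans h.symm)⟩
    · exact ⟨a, hwa.symm, hax⟩
  have hd1 := dist_eq_add_one_of_leaf hG.1 hw hvw
  obtain ⟨y, hxy, hd2⟩ := exists_adj_dist_eq_add_one hG.1 hvx.symm
  have hyw : y ≠ w := by
    rintro rfl
    omega
  have hdist := dist_add_two_le_card hG.1 hP
  have hn4 : 4 ≤ n := by
    have := hdist w v
    omega
  obtain ⟨m, rfl⟩ := Nat.exists_eq_add_of_le' hn4
  have hcard : Fintype.card ({w}ᶜ : Set V) = m + 3 := by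
    rw [card_compl_singleton, hn]
    rfl
  have htree := isTree_induce_leaf hG hwx hw
  have hIH : xiAC (pathGraph (m + 3)) ≤ xiAC (G.induce ({w}ᶜ : Set V)) := by
    have hnt : Nontrivial ({w}ᶜ : Set V) := Fintype.one_lt_card_iff_nontrivial.1 (by omega)
    by_cases hP' : Nonempty (G.induce ({w}ᶜ : Set V) ≃g pathGraph (m + 3))
    · exact xiAC_le_of_iso htree.1 hP'.some.symm
    · exact (ih (m + 3) (by omega) htree (by rwa [hcard]) hcard).le
  have hstep := xiAC_induce_leaf_add_le hG hab hwa hwb hwx hw hxy hyw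
  have hD : 2 ≤ deg G x :=
    (Set.one_lt_ncard_iff (Set.toFinite _)).2 ⟨w, y, hwx.symm, hxy, hyw.symm⟩
  have hecc : ∀ u, ecc G u + 1 ≤ m + 3 := fun u => by
    have : ecc G u ≤ m + 2 := ecc_le_iff.2 fun z => by
      have := hdist u z
      omega
    omega
  have hgain := xiAC_pathGraph_lt_add (n := m) (ecc_pos hG.1 y) (ecc_pos hG.1 w) (hecc y)
    (hecc w) hD fun hm hx => ecc_le_two_of_deg_eq_two hG.1 hwx hw hxy hyw hx fun z => by
      have := hdist w z
      omega
  linarith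

lemma xiAC_lt_of_connected_lt [Nontrivial V] {T : SimpleGraph V} (hT : T.Connected)
    (hTG : T < G) : xiAC T < xiAC G := by
  have hG : G.Connected := hT.mono hTG.le
  obtain ⟨x, y, hxy, hnxy⟩ : ∃ x y, G.Adj x y ∧ ¬ T.Adj x y := by
    by_contra! h
    exact hTG.not_ge fun x y hxy => h x y hxy
  obtain ⟨v, hv⟩ := exists_ne x
  obtain ⟨z, hxz, -⟩ := exists_adj_dist_eq_add_one hT hv.symm
  have h := xiAC_add_le_sum_of_hom (Hom.ofLE hTG.le) Function.injective_id
    (fun u => ecc_pos hG _)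
    (fun u => ecc_le_iff.2 fun v => ((hT u v).dist_anti hTG.le).trans (dist_le_ecc T u v))
    hxz.symm (deg_lt_of_hom (Hom.ofLE hTG.le) Function.injective_id (y := y) hxy
      fun v hv h => hnxy (h ▸ hv))
  have hpos : (0 : ℝ) < 1 / (ecc G z : ℝ) := by
    have : (0 : ℝ) < ecc G z := by exact_mod_cast ecc_pos hG z
    positivity
  have h' : xiAC T + 1 / (ecc G z : ℝ) ≤ xiAC G := h
  linarith

end Trees

/-- Proposition: For a simple connected graph `G ≠ P_n` on `n` vertices,
`ξ^{ac}(G) > ξ^{ac}(P_n)`. -/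
theorem xiAC_gt_path (n : ℕ) {V : Type*} [Fintype V] (G : SimpleGraph V)
    (hG : G.Connected) (hn : Fintype.card V = n)
    (hnotpath : ¬ Nonempty (G ≃g pathGraph n)) :
    xiAC (pathGraph n) < xiAC G := by
  subst hn
  have hne := hG.nonempty
  rcases subsingleton_or_nontrivial V with hV | hV
  · exact absurd (iso_pathGraph_of_dist_injective hG (a := hne.some)
      fun u v _ => Subsingleton.elim u v) hnotpath
  obtain ⟨T, hle, hT⟩ := hG.exists_isTree_le
  by_cases hP : Nonempty (T ≃g pathGraph (Fintype.card V))
  · have hlt : T < G := hle.lt_of_ne (by rintro rfl; exact hnotpath hP)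
    exact (xiAC_le_of_iso hT.1 hP.some.symm).trans_lt (xiAC_lt_of_connected_lt hT.1 hlt)
  · rcases hle.eq_or_lt with rfl | hlt
    · exact xiAC_tree_gt_path hT hP
    · exact (xiAC_tree_gt_path hT hP).trans (xiAC_lt_of_connected_lt hT.1 hlt)
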